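/- Let r be a positive integer, let Σ be a closed subset of ℝⁿ with 0 ∈ Σ, and let f: (ℝⁿ,0) → (ℝᵖ,0) be a C^{r+1} map-germ with n ≥ p. Then f satisfies condition (K̃_Σ^δ) if and only if for every C^{r+1} map-germ g with j^r g(Σ;0) = j^r f(Σ;0) there exist δ, C, α > 0 (depending on g) such that d(x,Σ)·κ(dg(x)) + ‖g(x)‖ ≥ C·d(x,Σ)^{r+1−δ} for all ‖x‖ < α. -/

import Mathlib

/-- The Kuo distance `κ(v₁,…,v_p) = min_i dist(v_i, span{v_j : j ≠ i})`. -/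
noncomputable def kuo {n p : ℕ} (v : Fin p → EuclideanSpace ℝ (Fin n)) : ℝ :=
  ⨅ i : Fin p, Metric.infDist (v i)
    (Submodule.span ℝ (v '' {j | j ≠ i}) : Set (EuclideanSpace ℝ (Fin n)))

/-- The gradient of the `i`-th component of `f` at `x`, i.e. `df*(x)` applied to the
`i`-th standard basis vector. -/
noncomputable def grad {n p : ℕ} (f : EuclideanSpace ℝ (Fin n) → EuclideanSpace ℝ (Fin p))
    (x : EuclideanSpace ℝ (Fin n)) (i : Fin p) : EuclideanSpace ℝ (Fin n) :=
  ContinuousLinearMap.adjoint (fderiv ℝ f x) (EuclideanSpace.single i 1)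

/-- `κ(df(x)) = κ(grad f₁(x),…,grad f_p(x))`. -/
noncomputable def kuoD {n p : ℕ} (f : EuclideanSpace ℝ (Fin n) → EuclideanSpace ℝ (Fin p))
    (x : EuclideanSpace ℝ (Fin n)) : ℝ :=
  kuo (grad f x)

/-- `j^r f(Σ;0) = j^r g(Σ;0)`: all partial derivatives of order ≤ r of `f` and `g`
coincide on `Σ ∩ U` for some neighbourhood `U` of the origin. -/
def jetEqual {n p : ℕ} (r : ℕ) (S : Set (EuclideanSpace ℝ (Fin n)))
    (f g : EuclideanSpace ℝ (Fin n) → EuclideanSpace ℝ (Fin p)) : Prop :=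
  ∃ U ∈ nhds (0 : EuclideanSpace ℝ (Fin n)), ∀ z ∈ S ∩ U, ∀ k : ℕ, k ≤ r →
    iteratedFDeriv ℝ k f z = iteratedFDeriv ℝ k g z

/-- Condition `(K̃_Σ^δ)`. -/
def KuoTildeDeltaRel {n p : ℕ} (r : ℕ) (S : Set (EuclideanSpace ℝ (Fin n)))
    (f : EuclideanSpace ℝ (Fin n) → EuclideanSpace ℝ (Fin p)) : Prop :=
  ∀ g : EuclideanSpace ℝ (Fin n) → EuclideanSpace ℝ (Fin p),
    ContDiff ℝ (r + 1) g → g 0 = 0 → jetEqual r S f g →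
    ∃ δ > (0:ℝ), ∃ C > (0:ℝ), ∃ α > (0:ℝ), ∀ x : EuclideanSpace ℝ (Fin n), ‖x‖ < α →
      Metric.infDist x S * kuoD f x + ‖g x‖ ≥ C * Metric.infDist x S ^ ((r : ℝ) + 1 - δ)

/-- Each coefficient of a linear combination is controlled by the norm of the combination
through the Kuo distance. -/
theorem abs_mul_kuo_le {n p : ℕ} (v : Fin p → EuclideanSpace ℝ (Fin n)) (c : Fin p → ℝ)
    (i : Fin p) : |c i| * kuo v ≤ ‖∑ j, c j • v j‖ := by
  by_cases hc : c i = 0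
  · simp [hc]
  have hpos : 0 < |c i| := abs_pos.mpr hc
  have hmem : -∑ j ∈ Finset.univ.erase i, ((c i)⁻¹ * c j) • v j ∈
      Submodule.span ℝ (v '' {j | j ≠ i}) := by
    refine Submodule.neg_mem _ (Submodule.sum_mem _ fun j hj => Submodule.smul_mem _ _ ?_)
    exact Submodule.subset_span ⟨j, Finset.ne_of_mem_erase hj, rfl⟩
  have h1 : kuo v ≤ Metric.infDist (v i)
      (Submodule.span ℝ (v '' {j | j ≠ i}) : Set (EuclideanSpace ℝ (Fin n))) :=
    ciInf_le (Set.finite_range _).bddBelow i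
  have h2 := h1.trans (Metric.infDist_le_dist_of_mem hmem)
  have h3 : ∑ j, c j • v j =
      c i • (v i - -∑ j ∈ Finset.univ.erase i, ((c i)⁻¹ * c j) • v j) := by
    rw [← Finset.add_sum_erase _ _ (Finset.mem_univ i), sub_neg_eq_add, smul_add,
      Finset.smul_sum]
    congr 1
    refine Finset.sum_congr rfl fun j _ => ?_
    rw [smul_smul, mul_inv_cancel_left₀ hc]
  rw [h3, norm_smul, Real.norm_eq_abs, ← dist_eq_norm]
  exact mul_le_mul_of_nonneg_left h2 hpos.le

/-- The Kuo distance is almost attained by a linear combination having a coefficient `1`. -/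
theorem exists_norm_sum_smul_lt_kuo_add {n p : ℕ} (hp : 1 ≤ p)
    (w : Fin p → EuclideanSpace ℝ (Fin n)) {ε : ℝ} (hε : 0 < ε) :
    ∃ (c : Fin p → ℝ) (i : Fin p), c i = 1 ∧ ‖∑ j, c j • w j‖ < kuo w + ε := by
  have : Nonempty (Fin p) := ⟨⟨0, hp⟩⟩
  obtain ⟨i, hi⟩ := exists_lt_of_ciInf_lt (lt_add_of_pos_right (kuo w) hε)
  obtain ⟨y, hy, hdist⟩ := (Metric.infDist_lt_iff ⟨0, Submodule.zero_mem _⟩).1 hi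
  obtain ⟨l, hl, rfl⟩ := (Finsupp.mem_span_image_iff_linearCombination ℝ).1 hy
  have hli : l i = 0 := by
    by_contra h
    exact (Finsupp.mem_supported _ _).1 hl (Finsupp.mem_support_iff.2 h) rfl
  refine ⟨fun j => (if j = i then 1 else 0) - l j, i, by simp [hli], ?_⟩
  have : ∑ j, ((if j = i then (1 : ℝ) else 0) - l j) • w j =
      w i - Finsupp.linearCombination ℝ w l := by
    simp [sub_smul, Finset.sum_sub_distrib, Finsupp.linearCombination_apply,
      Finsupp.sum_fintype]
  rw [this, ← dist_eq_norm]
  exact hdist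

/-- The Kuo distance is quasi-Lipschitz. -/
theorem kuo_le_mul_kuo_add {n p : ℕ} (hp : 1 ≤ p) (v w : Fin p → EuclideanSpace ℝ (Fin n))
    {M : ℝ} (hM : ∀ i, ‖v i - w i‖ ≤ M) : kuo v ≤ p * (kuo w + M) := by
  have hp0 : (0 : ℝ) < p := by exact_mod_cast hp
  refine le_of_forall_pos_le_add fun ε hε => ?_
  obtain ⟨c, i, hci, hlt⟩ := exists_norm_sum_smul_lt_kuo_add hp w (div_pos hε hp0)
  set s : ℝ := ∑ j, |c j| with hs
  have hs1 : 1 ≤ s := by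
    have := Finset.single_le_sum (f := fun j => |c j|) (fun j _ => abs_nonneg _)
      (Finset.mem_univ i)
    simpa [hci] using this
  have h1 : s * kuo v ≤ p * ‖∑ j, c j • v j‖ := by
    rw [hs, Finset.sum_mul]
    refine (Finset.sum_le_sum fun j _ => abs_mul_kuo_le v c j).trans ?_
    simp
  have h2 : ‖∑ j, c j • v j‖ ≤ ‖∑ j, c j • w j‖ + s * M := by
    have h : ∑ j, c j • v j = ∑ j, c j • w j + ∑ j, c j • (v j - w j) := by
      simp [smul_sub]
    rw [h]
    refine (norm_add_le _ _).trans (add_le_add_right ?_ _)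
    rw [hs, Finset.sum_mul]
    refine norm_sum_le_of_le _ fun j _ => ?_
    rw [norm_smul, Real.norm_eq_abs]
    exact mul_le_mul_of_nonneg_left (hM j) (abs_nonneg _)
  have h3 : p * (ε / p) = ε := by field_simp
  have hnn : 0 ≤ kuo w + ε / p := (norm_nonneg _).trans hlt.le
  have h4 : s * kuo v ≤ s * (p * (kuo w + M) + ε) := calc
    s * kuo v ≤ p * (‖∑ j, c j • w j‖ + s * M) := h1.trans (by gcongr)
    _ ≤ p * (s * (kuo w + ε / p) + s * M) := by
      gcongr
      exact hlt.le.trans (le_mul_of_one_le_left hnn hs1)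
    _ = s * (p * (kuo w + M) + p * (ε / p)) := by ring
    _ = s * (p * (kuo w + M) + ε) := by rw [h3]
  exact le_of_mul_le_mul_left h4 (by linarith)

/-- Taylor estimate: a map whose derivatives up to order `r` vanish at `z` has derivatives of
order `r + 1 - m` bounded by `K ‖x - z‖ ^ m`. -/
theorem norm_iteratedFDeriv_le_of_jet_eq_zero {E F : Type*} [NormedAddCommGroup E]
    [NormedSpace ℝ E] [NormedAddCommGroup F] [NormedSpace ℝ F] {r : ℕ} {h : E → F}
    (hh : ContDiff ℝ (r + 1) h) {B : Set E} (hB : Convex ℝ B) {K : ℝ}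
    (hK : ∀ x ∈ B, ‖iteratedFDeriv ℝ (r + 1) h x‖ ≤ K) {z : E} (hz : z ∈ B)
    (hjet : ∀ k ≤ r, iteratedFDeriv ℝ k h z = 0) (m k : ℕ) (hmk : k + m = r + 1) :
    ∀ x ∈ B, ‖iteratedFDeriv ℝ k h x‖ ≤ K * ‖x - z‖ ^ m := by
  have hK0 : 0 ≤ K := (norm_nonneg _).trans (hK z hz)
  induction m generalizing k with
  | zero =>
    obtain rfl : k = r + 1 := by omega
    simpa using hK
  | succ m ih =>
    intro x hx
    have hd : Differentiable ℝ (iteratedFDeriv ℝ k h) := by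
      refine hh.differentiable_iteratedFDeriv ?_
      exact_mod_cast (by omega : k < r + 1)
    have hseg : segment ℝ z x ⊆ B := hB.segment_subset hz hx
    have hbound : ∀ y ∈ segment ℝ z x,
        ‖fderiv ℝ (iteratedFDeriv ℝ k h) y‖ ≤ K * ‖x - z‖ ^ m := by
      intro y hy
      rw [norm_fderiv_iteratedFDeriv]
      refine (ih (k + 1) (by omega) y (hseg hy)).trans ?_
      have := norm_sub_le_of_mem_segment hy
      gcongr
    have := (convex_segment z x).norm_image_sub_le_of_norm_fderiv_le
      (fun y _ => hd y) hbound (left_mem_segment ℝ z x) (right_mem_segment ℝ z x)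
    rw [hjet k (by omega), sub_zero] at this
    rwa [pow_succ, ← mul_assoc]

/-- Two maps with the same `r`-jet along a closed set `S` have differentials that are
`d(x,S) ^ r`-close near the origin. -/
theorem exists_norm_fderiv_sub_le {n p r : ℕ} (S : Set (EuclideanSpace ℝ (Fin n)))
    (hS : IsClosed S) (h0S : (0 : EuclideanSpace ℝ (Fin n)) ∈ S)
    (f g : EuclideanSpace ℝ (Fin n) → EuclideanSpace ℝ (Fin p))
    (hf : ContDiff ℝ (r + 1) f) (hg : ContDiff ℝ (r + 1) g) (hjet : jetEqual r S f g) :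
    ∃ K ≥ (0 : ℝ), ∃ β > (0 : ℝ), ∀ x : EuclideanSpace ℝ (Fin n), ‖x‖ < β →
      ‖fderiv ℝ f x - fderiv ℝ g x‖ ≤ K * Metric.infDist x S ^ r := by
  obtain ⟨U, hU, hjet⟩ := hjet
  obtain ⟨ρ, hρ, hρU⟩ := Metric.mem_nhds_iff.1 hU
  have hh : ContDiff ℝ (r + 1) (f - g) := hf.sub hg
  have hcont : Continuous (iteratedFDeriv ℝ (r + 1) (f - g)) :=
    hh.continuous_iteratedFDeriv (by exact_mod_cast le_rfl)
  obtain ⟨K, hK⟩ := (isCompact_closedBall (0 : EuclideanSpace ℝ (Fin n)) ρ).exists_bound_of_continuousOn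
    hcont.continuousOn
  have hKB : ∀ x ∈ Metric.ball (0 : EuclideanSpace ℝ (Fin n)) ρ,
      ‖iteratedFDeriv ℝ (r + 1) (f - g) x‖ ≤ K := fun x hx => hK x (Metric.ball_subset_closedBall hx)
  refine ⟨K, (norm_nonneg _).trans (hK 0 (by simp [hρ.le])), ρ / 2, by positivity, fun x hx => ?_⟩
  obtain ⟨z, hzS, hz⟩ := hS.exists_infDist_eq_dist ⟨0, h0S⟩ x
  have hzx : dist x z ≤ ‖x‖ := by
    rw [← hz, ← dist_zero_right]
    exact Metric.infDist_le_dist_of_mem h0S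
  have hzB : z ∈ Metric.ball (0 : EuclideanSpace ℝ (Fin n)) ρ := by
    have := dist_triangle_left z 0 x
    rw [dist_zero_right, dist_zero_right] at this
    rw [mem_ball_zero_iff]
    linarith
  have hxB : x ∈ Metric.ball (0 : EuclideanSpace ℝ (Fin n)) ρ := by
    rw [mem_ball_zero_iff]
    linarith
  have hj : ∀ k ≤ r, iteratedFDeriv ℝ k (f - g) z = 0 := by
    intro k hk
    have hle : (k : WithTop ℕ∞) ≤ r + 1 := by exact_mod_cast hk.trans (Nat.le_succ r)
    rw [iteratedFDeriv_sub_apply (hf.of_le hle).contDiffAt (hg.of_le hle).contDiffAt,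
      hjet z ⟨hzS, hρU hzB⟩ k hk, sub_self]
  have := norm_iteratedFDeriv_le_of_jet_eq_zero hh (convex_ball 0 ρ) hKB hzB hj r 1
    (by omega) x hxB
  have hr0 : (r + 1 : WithTop ℕ∞) ≠ 0 := by simp
  rwa [norm_iteratedFDeriv_one, ← dist_eq_norm, ← hz,
    fderiv_sub (hf.differentiable hr0 x) (hg.differentiable hr0 x)] at this

/-- `κ(df)` and `κ(dg)` are comparable up to the distance between `df` and `dg`. -/
theorem kuoD_le_mul_kuoD_add {n p : ℕ} (hp : 1 ≤ p)
    (f g : EuclideanSpace ℝ (Fin n) → EuclideanSpace ℝ (Fin p)) (x : EuclideanSpace ℝ (Fin n)) :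
    kuoD f x ≤ p * (kuoD g x + ‖fderiv ℝ f x - fderiv ℝ g x‖) := by
  refine kuo_le_mul_kuo_add hp _ _ fun i => ?_
  have h : grad f x i - grad g x i =
      ContinuousLinearMap.adjoint (fderiv ℝ f x - fderiv ℝ g x) (EuclideanSpace.single i 1) := by
    simp [grad]
  rw [h]
  refine (ContinuousLinearMap.le_opNorm _ _).trans ?_
  rw [LinearIsometryEquiv.norm_map]
  simp

/-- A Łojasiewicz-type inequality for `κ(dφ)` passes to `κ(dψ)` if `φ` and `ψ` have the same
`r`-jet along `S`. -/
theorem lojasiewicz_transfer {n p r : ℕ} (hp : 1 ≤ p) (S : Set (EuclideanSpace ℝ (Fin n)))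
    (hS : IsClosed S) (h0S : (0 : EuclideanSpace ℝ (Fin n)) ∈ S)
    (φ ψ g : EuclideanSpace ℝ (Fin n) → EuclideanSpace ℝ (Fin p))
    (hφ : ContDiff ℝ (r + 1) φ) (hψ : ContDiff ℝ (r + 1) ψ) (hg0 : g 0 = 0)
    (hjet : jetEqual r S φ ψ)
    (H : ∃ δ > (0:ℝ), ∃ C > (0:ℝ), ∃ α > (0:ℝ), ∀ x : EuclideanSpace ℝ (Fin n), ‖x‖ < α →
      Metric.infDist x S * kuoD φ x + ‖g x‖ ≥ C * Metric.infDist x S ^ ((r : ℝ) + 1 - δ)) :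
    ∃ δ > (0:ℝ), ∃ C > (0:ℝ), ∃ α > (0:ℝ), ∀ x : EuclideanSpace ℝ (Fin n), ‖x‖ < α →
      Metric.infDist x S * kuoD ψ x + ‖g x‖ ≥ C * Metric.infDist x S ^ ((r : ℝ) + 1 - δ) := by
  obtain ⟨δ, hδ, C, hC, α, hα, H⟩ := H
  obtain ⟨K, hK, β, hβ, hKβ⟩ := exists_norm_fderiv_sub_le S hS h0S φ ψ hφ hψ hjet
  have hp1 : (1 : ℝ) ≤ p := by exact_mod_cast hp
  have hp0 : (0 : ℝ) < p := by linarith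
  have hne : (r : ℝ) + 1 - δ ≠ 0 := by
    intro h
    have := H 0 (by simpa using hα)
    rw [Metric.infDist_zero_of_mem h0S, h, hg0] at this
    simp at this
    linarith
  have hlim : Filter.Tendsto (fun t : ℝ => K * t ^ δ) (nhds 0) (nhds 0) := by
    have : Filter.Tendsto (fun t : ℝ => K * t ^ δ) (nhds 0) (nhds (K * 0 ^ δ)) :=
      (Real.continuousAt_rpow_const 0 δ (Or.inr hδ.le)).tendsto.const_mul K
    rwa [Real.zero_rpow hδ.ne', mul_zero] at this
  obtain ⟨γ, hγ, hγK⟩ := Metric.eventually_nhds_iff.1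
    (hlim.eventually_lt_const (show 0 < C / (2 * p) by positivity))
  refine ⟨δ, hδ, C / (2 * p), by positivity, min α (min β γ), by positivity, fun x hx => ?_⟩
  have hxα : ‖x‖ < α := hx.trans_le (min_le_left _ _)
  have hxβ : ‖x‖ < β := hx.trans_le ((min_le_right _ _).trans (min_le_left _ _))
  have hxγ : ‖x‖ < γ := hx.trans_le ((min_le_right _ _).trans (min_le_right _ _))
  have hdx : Metric.infDist x S ≤ ‖x‖ := by
    rw [← dist_zero_right]
    exact Metric.infDist_le_dist_of_mem h0S
  have hmain := H x hxα
  have hD := hKβ x hxβ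
  have hκ := kuoD_le_mul_kuoD_add hp φ ψ x
  rcases (Metric.infDist_nonneg (x := x) (s := S)).eq_or_lt with hd | hd
  · rw [← hd, Real.zero_rpow hne]
    simp
  set d := Metric.infDist x S
  have hsmall : K * d ^ δ < C / (2 * p) := by
    refine hγK ?_
    rw [Real.dist_eq, sub_zero, abs_of_pos hd]
    exact hdx.trans_lt hxγ
  set e := d ^ ((r : ℝ) + 1 - δ)
  have he : 0 < e := Real.rpow_pos_of_pos hd _
  have hpow : d * d ^ r = d ^ δ * e := by
    rw [← Real.rpow_add hd, ← pow_succ', ← Real.rpow_natCast]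
    congr 1
    push_cast
    ring
  have h1 : d * kuoD φ x ≤ p * (d * kuoD ψ x) + p * (K * d ^ δ * e) := calc
    d * kuoD φ x ≤ d * (p * (kuoD ψ x + K * d ^ r)) := by
      refine mul_le_mul_of_nonneg_left (hκ.trans ?_) hd.le
      gcongr
    _ = p * (d * kuoD ψ x) + p * (K * (d * d ^ r)) := by ring
    _ = p * (d * kuoD ψ x) + p * (K * d ^ δ * e) := by rw [hpow]; ring
  have h2 : p * (K * d ^ δ * e) ≤ p * (C / (2 * p) * e) := by gcongr
  have h3 : ‖g x‖ ≤ p * ‖g x‖ := le_mul_of_one_le_left (norm_nonneg _) hp1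
  have h4 : C * e = p * (C / (2 * p) * e) + p * (C / (2 * p) * e) := by
    field_simp
    ring
  have h5 : p * (C / (2 * p) * e) ≤ p * (d * kuoD ψ x + ‖g x‖) := by
    rw [mul_add]
    linarith
  exact le_of_mul_le_mul_left h5 hp0

/-- `(K̃_Σ^δ)` is equivalent to the same condition stated with `κ(dg(x))` instead of `κ(df(x))`. -/
theorem stmt12 {n p r : ℕ} (hr : 1 ≤ r) (hp : 1 ≤ p) (hnp : p ≤ n)
    (S : Set (EuclideanSpace ℝ (Fin n)))
    (hS : IsClosed S) (h0S : (0 : EuclideanSpace ℝ (Fin n)) ∈ S)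
    (f : EuclideanSpace ℝ (Fin n) → EuclideanSpace ℝ (Fin p))
    (hf : ContDiff ℝ (r + 1) f) (hf0 : f 0 = 0) :
    KuoTildeDeltaRel r S f ↔
      ∀ g : EuclideanSpace ℝ (Fin n) → EuclideanSpace ℝ (Fin p),
        ContDiff ℝ (r + 1) g → g 0 = 0 → jetEqual r S f g →
        ∃ δ > (0:ℝ), ∃ C > (0:ℝ), ∃ α > (0:ℝ), ∀ x : EuclideanSpace ℝ (Fin n), ‖x‖ < α →
          Metric.infDist x S * kuoD g x + ‖g x‖ ≥
            C * Metric.infDist x S ^ ((r : ℝ) + 1 - δ) := by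
  constructor
  · intro H g hg hg0 hjet
    exact lojasiewicz_transfer hp S hS h0S f g g hf hg hg0 hjet (H g hg hg0 hjet)
  · intro H g hg hg0 hjet
    have hjet' : jetEqual r S g f := by
      obtain ⟨U, hU, h⟩ := hjet
      exact ⟨U, hU, fun z hz k hk => (h z hz k hk).symm⟩
    exact lojasiewicz_transfer hp S hS h0S g f g hg hf hg0 hjet' (H g hg hg0 hjet)
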